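/- Let S ∈ 𝒮_t. Then φ_t^S : L^∞(F) → L^∞(F_t) defined by φ_t^S(Z) := π_t^S(Z e_1) is a univariate conditional convex risk measure: φ_t^S(0) ∈ L^∞(F_t); φ_t^S(Z + m) = φ_t^S(Z) − m for Z ∈ L^∞(F), m ∈ L^∞(F_t); Z_1 ≥ Z_2 a.s. implies φ_t^S(Z_1) ≤ φ_t^S(Z_2); and φ_t^S is conditionally convex (coherent when the acceptance set A_t is a conditional cone). Moreover, π_t^S(X) = φ_t^S(S_T^T X) for every X ∈ L^∞_d(F). -/

import Mathlib

open MeasureTheory Filter Set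
open scoped ENNReal

noncomputable section

namespace RiskPaper

variable {Ω : Type*}

/-- Euclidean inner product on `Fin d → ℝ`. -/
def dot {d : ℕ} (x y : Fin d → ℝ) : ℝ := ∑ i, x i * y i

/-- The first unit vector `e₁ = (1,0,…,0) ∈ ℝ^d`. -/
def e1 (d : ℕ) : Fin d → ℝ := fun i => if (i : ℕ) = 0 then 1 else 0

/-- The `i`-th unit vector of `ℝ^d`. -/
def eVec {d : ℕ} (i : Fin d) : Fin d → ℝ := fun j => if j = i then 1 else 0

/-- Measurability with respect to an explicitly given σ-algebra on the domain. -/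
def MeasF {α : Type*} [MeasurableSpace α] (m : MeasurableSpace Ω) (f : Ω → α) : Prop :=
  @Measurable Ω α m _ f

/-- `L^∞_d(F_t)`: bounded `F_t`-measurable `ℝ^d`-valued random variables
(pointwise representatives). -/
def LinfD (F : ℕ → MeasurableSpace Ω) (d t : ℕ) : Set (Ω → Fin d → ℝ) :=
  {X | MeasF (F t) X ∧ ∃ C : ℝ, ∀ ω i, |X ω i| ≤ C}

/-- `L^∞(F_t)`: bounded `F_t`-measurable scalar random variables. -/
def Linf (F : ℕ → MeasurableSpace Ω) (t : ℕ) : Set (Ω → ℝ) :=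
  {x | MeasF (F t) x ∧ ∃ C : ℝ, ∀ ω, |x ω| ≤ C}

/-- The eligible space `M_t = L^∞(F_t) × {0}^{d-1}` (portfolios held in the first asset). -/
def Mt (F : ℕ → MeasurableSpace Ω) (d t : ℕ) : Set (Ω → Fin d → ℝ) :=
  {m | m ∈ LinfD F d t ∧ ∀ ω, ∀ i : Fin d, (i : ℕ) ≠ 0 → m ω i = 0}

/-- The nonnegative elements `M_{t,+}` of `M_t`. -/
def MtPlus (F : ℕ → MeasurableSpace Ω) (d t : ℕ) : Set (Ω → Fin d → ℝ) :=
  {m | m ∈ Mt F d t ∧ ∀ ω i, 0 ≤ m ω i}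

/-- Structural assumptions on the filtration `(F_t)_{t=0}^T`: increasing, contained in the
ambient σ-algebra, `F_T` equal to the ambient σ-algebra, and `F_0` `P`-trivial. -/
def FiltrationOK [m0 : MeasurableSpace Ω] (F : ℕ → MeasurableSpace Ω) (P : Measure Ω)
    (T : ℕ) : Prop :=
  (∀ s t : ℕ, s ≤ t → F s ≤ F t) ∧ (∀ t, F t ≤ m0) ∧ F T = m0 ∧
    ∀ A : Set Ω, MeasurableSet[F 0] A → P A = 0 ∨ P A = 1

section Meas
variable [MeasurableSpace Ω]

/-- `g` is (a version of) the essential infimum of the set `A` of random variables. -/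
def IsEssInfSet (P : Measure Ω) (A : Set (Ω → ℝ)) (g : Ω → ℝ) : Prop :=
  (∀ f ∈ A, ∀ᵐ ω ∂P, g ω ≤ f ω) ∧
    ∀ h : Ω → ℝ, (∀ f ∈ A, ∀ᵐ ω ∂P, h ω ≤ f ω) → ∀ᵐ ω ∂P, h ω ≤ g ω

/-- `g` is (a version of) the essential supremum of the set `A` of random variables. -/
def IsEssSupSet (P : Measure Ω) (A : Set (Ω → ℝ)) (g : Ω → ℝ) : Prop :=
  (∀ f ∈ A, ∀ᵐ ω ∂P, f ω ≤ g ω) ∧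
    ∀ h : Ω → ℝ, (∀ f ∈ A, ∀ᵐ ω ∂P, f ω ≤ h ω) → ∀ᵐ ω ∂P, g ω ≤ h ω

/-- Essential supremum of a set of extended-real-valued random variables
(to accommodate the values `±∞`). -/
def IsEssSupSetE (P : Measure Ω) (A : Set (Ω → EReal)) (g : Ω → EReal) : Prop :=
  (∀ f ∈ A, ∀ᵐ ω ∂P, f ω ≤ g ω) ∧
    ∀ h : Ω → EReal, (∀ f ∈ A, ∀ᵐ ω ∂P, f ω ≤ h ω) → ∀ᵐ ω ∂P, g ω ≤ h ω

/-- Essential infimum of a set of extended-real-valued random variables. -/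
def IsEssInfSetE (P : Measure Ω) (A : Set (Ω → EReal)) (g : Ω → EReal) : Prop :=
  (∀ f ∈ A, ∀ᵐ ω ∂P, g ω ≤ f ω) ∧
    ∀ h : Ω → EReal, (∀ f ∈ A, ∀ᵐ ω ∂P, h ω ≤ f ω) → ∀ᵐ ω ∂P, h ω ≤ g ω

/-- An (extended-real-valued) random variable lies in `L^∞(F_t)`:
it agrees `P`-a.s. with a bounded `F_t`-measurable real random variable. -/
def MemLinfE (F : ℕ → MeasurableSpace Ω) (P : Measure Ω) (t : ℕ) (g : Ω → EReal) : Prop :=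
  ∃ x ∈ Linf F t, g =ᵐ[P] fun ω => (x ω : EReal)

/-- The Radon–Nikodym density `dQ/dP` as a real random variable. -/
def rnd (P Q : Measure Ω) : Ω → ℝ := fun ω => (Q.rnDeriv P ω).toReal

/-- `ξ̄_{t,T}(Q) = (dQ/dP)/E[dQ/dP | F_t]` on `{E[dQ/dP|F_t] > 0}` and `1` elsewhere. -/
def xiBar (F : ℕ → MeasurableSpace Ω) (P Q : Measure Ω) (t : ℕ) : Ω → ℝ := fun ω =>
  if 0 < (P[rnd P Q | F t]) ω then rnd P Q ω / (P[rnd P Q | F t]) ω else 1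

/-- The `P`-a.s. version of the conditional expectation `E^Q[x | F_t]`, defined as
`E[ξ̄_{t,T}(Q) x | F_t]`. -/
def EQcond (F : ℕ → MeasurableSpace Ω) (P Q : Measure Ω) (t : ℕ) (x : Ω → ℝ) : Ω → ℝ :=
  P[fun ω => xiBar F P Q t ω * x ω | F t]

end Meas

/-- The solvency regions are closed convex cones (pointwise in `ω`). -/
def ConesOK {d : ℕ} (K : ℕ → Ω → Set (Fin d → ℝ)) : Prop :=
  ∀ s (ω : Ω), IsClosed (K s ω) ∧ Convex ℝ (K s ω) ∧
    (0 : Fin d → ℝ) ∈ K s ω ∧ ∀ c : ℝ, 0 ≤ c → ∀ x ∈ K s ω, c • x ∈ K s ω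

/-- The trading set `𝕂_t = Σ_{s=t}^T L^∞_d(F_s; K_s)`. -/
def KK (F : ℕ → MeasurableSpace Ω) (d T : ℕ) (K : ℕ → Ω → Set (Fin d → ℝ)) (t : ℕ) :
    Set (Ω → Fin d → ℝ) :=
  {X | ∃ k : ℕ → Ω → Fin d → ℝ,
      (∀ s, t ≤ s → s ≤ T → k s ∈ LinfD F d s ∧ ∀ ω, k s ω ∈ K s ω) ∧
      ∀ ω, X ω = ∑ s ∈ Finset.Icc t T, k s ω}

/-- Assumption 2.2 of the paper: `K_T ⊇ K̄` a.s. for a convex cone `K̄` with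
`int K̄ ⊇ ℝ^d_+ \ {0}`. -/
def FrictionAssumption [MeasurableSpace Ω] (P : Measure Ω) {d : ℕ} (T : ℕ)
    (K : ℕ → Ω → Set (Fin d → ℝ)) : Prop :=
  ∃ Kbar : Set (Fin d → ℝ), Convex ℝ Kbar ∧
    (∀ c : ℝ, 0 ≤ c → ∀ x ∈ Kbar, c • x ∈ Kbar) ∧
    {x : Fin d → ℝ | (∀ i, 0 ≤ x i) ∧ x ≠ 0} ⊆ interior Kbar ∧
    ∀ᵐ ω ∂P, Kbar ⊆ K T ω

/-- The norm `‖x‖_{𝕂_T,0}` for a deterministic portfolio `x ∈ ℝ^d`: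
`inf{c ∈ ℝ : c e₁ − x ∈ 𝕂_T, x + c e₁ ∈ 𝕂_T}`. -/
def normKT0 (F : ℕ → MeasurableSpace Ω) (d T : ℕ) (K : ℕ → Ω → Set (Fin d → ℝ))
    (x : Fin d → ℝ) : ℝ :=
  sInf {c : ℝ | (fun (_ : Ω) i => c * e1 d i - x i) ∈ KK F d T K T ∧
      (fun (_ : Ω) i => x i + c * e1 d i) ∈ KK F d T K T}

/-- The positive dual cone of a set `C ⊆ ℝ^d`. -/
def dualCone {d : ℕ} (C : Set (Fin d → ℝ)) : Set (Fin d → ℝ) := {y | ∀ x ∈ C, 0 ≤ dot x y}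

section MeasP
variable [MeasurableSpace Ω]

/-- The positive dual cone `𝕂_t^+ ⊆ L^1_d` of the trading set `𝕂_t`. -/
def KKplus (F : ℕ → MeasurableSpace Ω) (P : Measure Ω) (d T : ℕ)
    (K : ℕ → Ω → Set (Fin d → ℝ)) (t : ℕ) : Set (Ω → Fin d → ℝ) :=
  {v | (∀ i : Fin d, Integrable (fun ω => v ω i) P) ∧
      ∀ u ∈ KK F d T K t, 0 ≤ ∫ ω, dot (v ω) (u ω) ∂P}

/-- `(Q,S) ∈ 𝒬_t`: `Q ≪ P` a probability measure and `(S_s)_{s=t}^T` a consistent pricing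
process with `S_{s,1} ≡ 1`, the `L^∞` bound `‖S_{s,i}‖_∞ ≤ max{‖e_i‖_{𝕂_T,0},1}`,
`S_s = E^Q[S_T | F_s]` and `(dQ/dP) S_T ∈ 𝕂_t^+`. -/
def memQt (F : ℕ → MeasurableSpace Ω) (P : Measure Ω) (d T : ℕ)
    (K : ℕ → Ω → Set (Fin d → ℝ)) (t : ℕ) (Q : Measure Ω) (S : ℕ → Ω → Fin d → ℝ) : Prop :=
  IsProbabilityMeasure Q ∧ Q ≪ P ∧
    (∀ s, t ≤ s → s ≤ T →
      S s ∈ LinfD F d s ∧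
      (∀ ω, ∀ i : Fin d, (i : ℕ) = 0 → S s ω i = 1) ∧
      (∀ i : Fin d, ∀ ω, |S s ω i| ≤ max (normKT0 F d T K (eVec i)) 1) ∧
      ∀ i : Fin d, (fun ω => S s ω i) =ᵐ[P] EQcond F P Q s fun ω => S T ω i) ∧
    (fun ω i => rnd P Q ω * S T ω i) ∈ KKplus F P d T K t

/-- `(Q,S) ∈ 𝒬_t^e`: additionally `Q` is equivalent to `P`. -/
def memQtE (F : ℕ → MeasurableSpace Ω) (P : Measure Ω) (d T : ℕ)
    (K : ℕ → Ω → Set (Fin d → ℝ)) (t : ℕ) (Q : Measure Ω) (S : ℕ → Ω → Fin d → ℝ) : Prop :=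
  memQt F P d T K t Q S ∧ P ≪ Q

/-- The set `𝒮` of eligible (frictionless) pricing processes. -/
def memS (F : ℕ → MeasurableSpace Ω) (d T : ℕ) (K : ℕ → Ω → Set (Fin d → ℝ))
    (S : ℕ → Ω → Fin d → ℝ) : Prop :=
  ∀ t ≤ T, S t ∈ LinfD F d t ∧ (∀ ω, S t ω ∈ dualCone (K t ω)) ∧
    (∀ ω, ∀ i : Fin d, (i : ℕ) = 0 → S t ω i = 1) ∧
    ∀ i : Fin d, ∀ ω, |S t ω i| ≤ max (normKT0 F d T K (eVec i)) 1

/-- `Q ∈ 𝒬^e(S)`: `Q` is a probability measure equivalent to `P` under which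
`S` is a martingale (with the `P`-a.s. version of conditional expectations). -/
def QeS (F : ℕ → MeasurableSpace Ω) (P : Measure Ω) (d T : ℕ)
    (S : ℕ → Ω → Fin d → ℝ) : Set (Measure Ω) :=
  {Q | IsProbabilityMeasure Q ∧ Q ≪ P ∧ P ≪ Q ∧
    ∀ s ≤ T, ∀ i : Fin d, (fun ω => S s ω i) =ᵐ[P] EQcond F P Q s fun ω => S T ω i}

/-- The cone `Γ_t(S_t) = {Z ∈ L^∞_d(F_t) : S_t^⊤ Z ≥ 0 a.s.}`. -/
def Gamma (F : ℕ → MeasurableSpace Ω) (P : Measure Ω) (d : ℕ)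
    (S : ℕ → Ω → Fin d → ℝ) (t : ℕ) : Set (Ω → Fin d → ℝ) :=
  {Z | Z ∈ LinfD F d t ∧ ∀ᵐ ω ∂P, 0 ≤ dot (S t ω) (Z ω)}

/-- The set `Σ_{s=0}^T Γ_s(S_s)` of claims attainable from zero. -/
def SumGamma (F : ℕ → MeasurableSpace Ω) (P : Measure Ω) (d T : ℕ)
    (S : ℕ → Ω → Fin d → ℝ) : Set (Ω → Fin d → ℝ) :=
  {X | ∃ Z : ℕ → Ω → Fin d → ℝ, (∀ s ≤ T, Z s ∈ Gamma F P d S s) ∧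
      ∀ ω, X ω = ∑ s ∈ Finset.range (T + 1), Z s ω}

/-- The no-arbitrage condition (NA):
`[Σ_{s=0}^T Γ_s(S_s)] ∩ [−Γ_T(S_T)] ⊆ Γ_T(S_T)`. -/
def NoArb (F : ℕ → MeasurableSpace Ω) (P : Measure Ω) (d T : ℕ)
    (S : ℕ → Ω → Fin d → ℝ) : Prop :=
  ∀ X ∈ SumGamma F P d T S, (fun ω => -X ω) ∈ Gamma F P d S T → X ∈ Gamma F P d S T

/-- `ρ_t` is a scalarized conditional convex risk measure: finite (`L^∞(F_t)`-valued),
conditionally cash invariant in the first asset, monotone, conditionally convex. -/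
structure ScalarRM (F : ℕ → MeasurableSpace Ω) (P : Measure Ω) (d T t : ℕ)
    (rho : (Ω → Fin d → ℝ) → Ω → ℝ) : Prop where
  finite : ∀ X ∈ LinfD F d T, ∃ g ∈ Linf F t, rho X =ᵐ[P] g
  cash : ∀ X ∈ LinfD F d T, ∀ m ∈ Linf F t,
    rho (fun ω => X ω + m ω • e1 d) =ᵐ[P] fun ω => rho X ω - m ω
  mono : ∀ X ∈ LinfD F d T, ∀ Y ∈ LinfD F d T,
    (∀ ω i, X ω i ≤ Y ω i) → rho Y ≤ᵐ[P] rho X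
  convex : ∀ X ∈ LinfD F d T, ∀ Y ∈ LinfD F d T, ∀ lam ∈ Linf F t,
    (∀ ω, lam ω ∈ Set.Icc (0 : ℝ) 1) →
    rho (fun ω => lam ω • X ω + (1 - lam ω) • Y ω) ≤ᵐ[P]
      fun ω => lam ω * rho X ω + (1 - lam ω) * rho Y ω

/-- Conditional positive homogeneity (coherence). -/
def CoherentRM (F : ℕ → MeasurableSpace Ω) (P : Measure Ω) (d T t : ℕ)
    (rho : (Ω → Fin d → ℝ) → Ω → ℝ) : Prop :=
  ∀ X ∈ LinfD F d T, ∀ lam ∈ Linf F t, (∀ ω, 0 ≤ lam ω) →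
    rho (fun ω => lam ω • X ω) =ᵐ[P] fun ω => lam ω * rho X ω

/-- `𝕂_t`-compatibility of a scalar risk measure:
`ρ_t(X) = essinf_{k ∈ 𝕂_t} ρ_t(X−k)`. -/
def KCompat (F : ℕ → MeasurableSpace Ω) (P : Measure Ω) (d T : ℕ)
    (K : ℕ → Ω → Set (Fin d → ℝ)) (t : ℕ) (rho : (Ω → Fin d → ℝ) → Ω → ℝ) : Prop :=
  ∀ X ∈ LinfD F d T,
    IsEssInfSet P {g | ∃ k ∈ KK F d T K t, g = rho fun ω => X ω - k ω} (rho X)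

/-- The acceptance set `A_t = {X ∈ L^∞_d(F) : ρ_t(X) ≤ 0}`. -/
def Acc (F : ℕ → MeasurableSpace Ω) (P : Measure Ω) (d T : ℕ)
    (rho : (Ω → Fin d → ℝ) → Ω → ℝ) : Set (Ω → Fin d → ℝ) :=
  {X | X ∈ LinfD F d T ∧ ∀ᵐ ω ∂P, rho X ω ≤ 0}

/-- `β` is (a version of) the penalty function
`β_t(Q,S) = esssup_{Z ∈ A} −E^Q[S_T^⊤ Z | F_t]`. -/
def IsPenalty (F : ℕ → MeasurableSpace Ω) (P : Measure Ω) (d T t : ℕ)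
    (A : Set (Ω → Fin d → ℝ)) (Q : Measure Ω) (S : ℕ → Ω → Fin d → ℝ)
    (beta : Ω → EReal) : Prop :=
  IsEssSupSetE P
    {g | ∃ Z ∈ A, g = fun ω =>
      ((-(EQcond F P Q t (fun ω' => dot (S T ω') (Z ω')) ω) : ℝ) : EReal)} beta

/-- `g` is (a version of) `π_t^S(X) = esssup_{Q ∈ 𝒬^e(S)} (−β_t(Q,S) − E^Q[S_T^⊤ X|F_t])`. -/
def IsPi (F : ℕ → MeasurableSpace Ω) (P : Measure Ω) (d T t : ℕ)
    (beta : Measure Ω → Ω → EReal) (S : ℕ → Ω → Fin d → ℝ) (X : Ω → Fin d → ℝ)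
    (g : Ω → EReal) : Prop :=
  IsEssSupSetE P
    {h | ∃ Q ∈ QeS F P d T S, h = fun ω =>
      -beta Q ω - ((EQcond F P Q t (fun ω' => dot (S T ω') (X ω')) ω : ℝ) : EReal)} g

/-- The Fatou property of `ρ_t`. -/
def Fatou (F : ℕ → MeasurableSpace Ω) (P : Measure Ω) (d T : ℕ)
    (rho : (Ω → Fin d → ℝ) → Ω → ℝ) : Prop :=
  ∀ X ∈ LinfD F d T, ∀ Xn : ℕ → Ω → Fin d → ℝ, (∀ n, Xn n ∈ LinfD F d T) →
    (∃ C : ℝ, ∀ n ω i, |Xn n ω i| ≤ C) →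
    (∀ᵐ ω ∂P, Tendsto (fun n => Xn n ω) atTop (nhds (X ω))) →
    ∀ᵐ ω ∂P, rho X ω ≤ atTop.liminf fun n => rho (Xn n) ω

/-- Relevance (sensitivity): `P(ρ_t(−ε 1_D e₁) > ρ_t(0)) > 0` for all `ε > 0` and all
`D ∈ F` with positive probability. -/
def Relevant (P : Measure Ω) (d : ℕ) (rho : (Ω → Fin d → ℝ) → Ω → ℝ) : Prop :=
  ∀ ε : ℝ, 0 < ε → ∀ D : Set Ω, MeasurableSet D → 0 < P D →
    0 < P {ω | rho (fun _ _ => 0) ω <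
      rho (fun ω' => (-(ε * D.indicator (fun _ => (1 : ℝ)) ω')) • e1 d) ω}

end MeasP

section EssSup

private lemma strictAnti_inv_one_add_exp :
    StrictAnti fun x : EReal => (1 + EReal.exp x)⁻¹ := by
  intro x y hxy
  have h := EReal.exp_strictMono hxy
  exact ENNReal.inv_lt_inv.2 (ENNReal.add_lt_add_left ENNReal.one_ne_top h)

private lemma measurable_inv_one_add_exp :
    Measurable fun x : EReal => (1 + EReal.exp x)⁻¹ :=
  (measurable_const.add EReal.measurable_exp).inv

/-- A family of random variables measurable with respect to `m` has an essential upper bound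
which is the supremum of a countable subfamily. -/
lemma exists_countable_iSup_isUpperBound [m0 : MeasurableSpace Ω] (P : Measure Ω)
    [IsFiniteMeasure P] (A : Set (Ω → EReal)) (hA : ∀ f ∈ A, Measurable f) :
    ∃ C ⊆ A, C.Countable ∧ ∀ f ∈ A, ∀ᵐ ω ∂P, f ω ≤ ⨆ g ∈ C, g ω := by
  let V : Set (Ω → EReal) → ℝ≥0∞ := fun C =>
    ∫⁻ ω, (1 + EReal.exp (⨆ g ∈ C, g ω))⁻¹ ∂P
  have hmeas : ∀ C ⊆ A, C.Countable → Measurable fun ω => ⨆ g ∈ C, (g ω : EReal) :=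
    fun C hCA hC => Measurable.biSup C hC fun g hg => hA g (hCA hg)
  let R : Set ℝ≥0∞ := {v | ∃ C ⊆ A, C.Countable ∧ V C = v}
  have hR : R.Nonempty := ⟨V ∅, ∅, empty_subset _, countable_empty, rfl⟩
  obtain ⟨u, -, hu, hmem⟩ := exists_seq_tendsto_sInf hR (OrderBot.bddBelow R)
  choose C hCA hC hV using hmem
  have hUA : (⋃ n, C n) ⊆ A := iUnion_subset hCA
  have hU : (⋃ n, C n).Countable := countable_iUnion hC
  have anti : ∀ C D : Set (Ω → EReal), C ⊆ D → ∀ ω,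
      (1 + EReal.exp (⨆ g ∈ D, g ω))⁻¹ ≤ (1 + EReal.exp (⨆ g ∈ C, g ω))⁻¹ :=
    fun C D hCD ω => strictAnti_inv_one_add_exp.antitone (biSup_mono hCD)
  have hmin : V (⋃ n, C n) ≤ sInf R :=
    ge_of_tendsto' hu fun n => hV n ▸ lintegral_mono (anti _ _ (subset_iUnion C n))
  refine ⟨⋃ n, C n, hUA, hU, fun f hf => ?_⟩
  have hIA : insert f (⋃ n, C n) ⊆ A := insert_subset hf hUA
  have hI : (insert f (⋃ n, C n)).Countable := hU.insert f
  have hle : V (⋃ n, C n) ≤ V (insert f (⋃ n, C n)) :=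
    hmin.trans (sInf_le ⟨_, hIA, hI, rfl⟩)
  have hfin : V (insert f (⋃ n, C n)) ≠ ⊤ := by
    refine ne_top_of_le_ne_top (measure_ne_top P univ) ?_
    calc V (insert f (⋃ n, C n)) ≤ ∫⁻ _, 1 ∂P :=
          lintegral_mono fun ω => ENNReal.inv_le_one.2 le_self_add
      _ = P univ := by simp
  have heq := ae_eq_of_ae_le_of_lintegral_le
    (Eventually.of_forall (anti _ _ (subset_insert f (⋃ n, C n)))) hfin
    (measurable_inv_one_add_exp.comp (hmeas _ hUA hU)).aemeasurable hle
  filter_upwards [heq] with ω hω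
  have h := strictAnti_inv_one_add_exp.injective hω
  rw [← h]
  exact le_biSup (fun g : Ω → EReal => g ω) (mem_insert f _)

/-- The essential supremum of a family of (a.s. versions of) `m`-measurable random variables has
an `m`-measurable version. -/
lemma IsEssSupSetE.exists_measurable {m : MeasurableSpace Ω} [m0 : MeasurableSpace Ω]
    {P : Measure Ω} [IsFiniteMeasure P] (hm : m ≤ m0) {A : Set (Ω → EReal)}
    {g : Ω → EReal} (hg : IsEssSupSetE P A g)
    (hA : ∀ f ∈ A, ∃ f', Measurable[m] f' ∧ f =ᵐ[P] f') :
    ∃ g', Measurable[m] g' ∧ g =ᵐ[P] g' := by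
  let B : Set (Ω → EReal) := {f' | Measurable[m] f' ∧ ∃ f ∈ A, f =ᵐ[P] f'}
  obtain ⟨C, hCB, hC, hub⟩ :=
    exists_countable_iSup_isUpperBound P B fun f hf => hf.1.mono hm le_rfl
  refine ⟨fun ω => ⨆ f ∈ C, f ω, Measurable.biSup C hC fun f hf => (hCB hf).1, ?_⟩
  have hle : ∀ᵐ ω ∂P, g ω ≤ ⨆ f ∈ C, f ω := by
    refine hg.2 _ fun f hf => ?_
    obtain ⟨f', hf', hff'⟩ := hA f hf
    filter_upwards [hff', hub f' ⟨hf', f, hf, hff'⟩] with ω h1 h2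
    rwa [h1]
  have hge : ∀ᵐ ω ∂P, ∀ f ∈ C, f ω ≤ g ω := by
    refine (ae_ball_iff hC).2 fun f' hf' => ?_
    obtain ⟨f, hf, hff'⟩ := (hCB hf').2
    filter_upwards [hff', hg.1 f hf] with ω h1 h2
    rwa [← h1]
  filter_upwards [hle, hge] with ω h1 h2
  exact le_antisymm h1 (iSup₂_le h2)

end EssSup

section CondExp

variable [m0 : MeasurableSpace Ω]

lemma ae_condExp_rnd_pos {F : ℕ → MeasurableSpace Ω} {P Q : Measure Ω} [IsFiniteMeasure P]
    [IsFiniteMeasure Q] {t : ℕ} (hm : F t ≤ m0) (hQP : Q ≪ P) (hPQ : P ≪ Q) :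
    ∀ᵐ ω ∂P, 0 < (P[rnd P Q | F t]) ω := by
  have h1 := ae_of_ae_trim hm (toReal_rnDeriv_trim hm hQP)
  have h2 := ae_of_ae_trim hm (Measure.rnDeriv_pos' (hPQ.trim hm))
  have h3 := ae_of_ae_trim hm (Measure.rnDeriv_lt_top (Q.trim hm) (P.trim hm))
  filter_upwards [h1, h2, h3] with ω h1 h2 h3
  change 0 < (P[fun ω => (Q.rnDeriv P ω).toReal | F t]) ω
  rw [← h1]
  exact ENNReal.toReal_pos h2.ne' h3.ne

lemma xiBar_ae_eq {F : ℕ → MeasurableSpace Ω} {P Q : Measure Ω} [IsFiniteMeasure P]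
    [IsFiniteMeasure Q] {t : ℕ} (hm : F t ≤ m0) (hQP : Q ≪ P) (hPQ : P ≪ Q) :
    xiBar F P Q t =ᵐ[P] rnd P Q * fun ω => ((P[rnd P Q | F t]) ω)⁻¹ := by
  filter_upwards [ae_condExp_rnd_pos hm hQP hPQ] with ω h
  simp [xiBar, h, div_eq_mul_inv]

lemma integrable_rnd (P Q : Measure Ω) [IsFiniteMeasure Q] : Integrable (rnd P Q) P :=
  Measure.integrable_toReal_rnDeriv

lemma integrable_xiBar {F : ℕ → MeasurableSpace Ω} {P Q : Measure Ω} [IsFiniteMeasure P]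
    [IsFiniteMeasure Q] {t : ℕ} (hm : F t ≤ m0) (hQP : Q ≪ P) (hPQ : P ≪ Q) :
    Integrable (xiBar F P Q t) P := by
  refine Integrable.congr ?_ (xiBar_ae_eq hm hQP hPQ).symm
  set D := P[rnd P Q | F t] with hD
  have hDm : Measurable[F t] D := stronglyMeasurable_condExp.measurable
  have hDi : Measurable[F t] fun ω => ENNReal.ofReal (D ω)⁻¹ := hDm.inv.ennreal_ofReal
  have hDi0 : Measurable fun ω => ENNReal.ofReal (D ω)⁻¹ := hDi.mono hm le_rfl
  have hrm : Measurable (rnd P Q) := (Measure.measurable_rnDeriv Q P).ennreal_toReal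
  refine ⟨(hrm.mul ((hDm.mono hm le_rfl).inv)).aestronglyMeasurable, ?_⟩
  have h1 : ∀ᵐ ω ∂P, ‖(rnd P Q * fun ω => (D ω)⁻¹) ω‖ₑ
      = Q.rnDeriv P ω * ENNReal.ofReal (D ω)⁻¹ := by
    filter_upwards [ae_condExp_rnd_pos hm hQP hPQ, Measure.rnDeriv_lt_top Q P] with ω h h'
    have h0 : 0 ≤ rnd P Q ω := ENNReal.toReal_nonneg
    have hi : 0 ≤ (D ω)⁻¹ := inv_nonneg.2 h.le
    rw [Pi.mul_apply, Real.enorm_eq_ofReal (mul_nonneg h0 hi), ENNReal.ofReal_mul h0, rnd,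
      ENNReal.ofReal_toReal h'.ne]
  rw [HasFiniteIntegral, lintegral_congr_ae h1, lintegral_rnDeriv_mul hQP hDi0.aemeasurable,
    ← lintegral_trim hm hDi, ← lintegral_rnDeriv_mul (hQP.trim hm) hDi.aemeasurable]
  calc _ ≤ ∫⁻ _, 1 ∂(P.trim hm) := by
        refine lintegral_mono_ae ?_
        filter_upwards [rnDeriv_trim hm hQP] with ω h
        rw [h]
        change ENNReal.ofReal (D ω) * ENNReal.ofReal (D ω)⁻¹ ≤ 1
        rcases le_or_gt (D ω) 0 with h0 | h0
        · simp [ENNReal.ofReal_of_nonpos h0]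
        · rw [← ENNReal.ofReal_mul h0.le, mul_inv_cancel₀ h0.ne']
          simp
    _ < ⊤ := by simp

lemma condExp_xiBar {F : ℕ → MeasurableSpace Ω} {P Q : Measure Ω} [IsFiniteMeasure P]
    [IsFiniteMeasure Q] {t : ℕ} (hm : F t ≤ m0) (hQP : Q ≪ P) (hPQ : P ≪ Q) :
    P[xiBar F P Q t | F t] =ᵐ[P] 1 := by
  have hx := xiBar_ae_eq hm hQP hPQ
  have hD : StronglyMeasurable[F t] fun ω => ((P[rnd P Q | F t]) ω)⁻¹ :=
    (Measurable.inv stronglyMeasurable_condExp.measurable).stronglyMeasurable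
  have h := condExp_mul_of_stronglyMeasurable_right hD
    ((integrable_xiBar hm hQP hPQ).congr hx) (integrable_rnd P Q)
  filter_upwards [condExp_congr_ae (m := F t) hx, h, ae_condExp_rnd_pos hm hQP hPQ]
    with ω h1 h2 h3
  rw [h1, h2, Pi.mul_apply, mul_inv_cancel₀ h3.ne', Pi.one_apply]

lemma xiBar_nonneg (F : ℕ → MeasurableSpace Ω) (P Q : Measure Ω) (t : ℕ) (ω : Ω) :
    0 ≤ xiBar F P Q t ω := by
  unfold xiBar
  split_ifs with h
  · exact div_nonneg ENNReal.toReal_nonneg h.le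
  · exact zero_le_one

lemma measurable_of_mem_Linf {F : ℕ → MeasurableSpace Ω} {s : ℕ} (hs : F s ≤ m0) {X : Ω → ℝ}
    (hX : X ∈ Linf F s) : Measurable X :=
  Measurable.mono hX.1 hs le_rfl

lemma integrable_xiBar_mul {F : ℕ → MeasurableSpace Ω} {P Q : Measure Ω} [IsFiniteMeasure P]
    [IsFiniteMeasure Q] {s t : ℕ} (hs : F s ≤ m0) (hm : F t ≤ m0) (hQP : Q ≪ P) (hPQ : P ≪ Q)
    {X : Ω → ℝ} (hX : X ∈ Linf F s) :
    Integrable (fun ω => xiBar F P Q t ω * X ω) P := by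
  obtain ⟨C, hC⟩ := hX.2
  simpa only [mul_comm] using (integrable_xiBar hm hQP hPQ).bdd_mul (c := C)
    (measurable_of_mem_Linf hs hX).aestronglyMeasurable (Eventually.of_forall hC)

lemma EQcond_mono {F : ℕ → MeasurableSpace Ω} {P Q : Measure Ω} [IsFiniteMeasure P]
    [IsFiniteMeasure Q] {s t : ℕ} (hs : F s ≤ m0) (hm : F t ≤ m0) (hQP : Q ≪ P) (hPQ : P ≪ Q)
    {X Y : Ω → ℝ} (hX : X ∈ Linf F s) (hY : Y ∈ Linf F s) (hXY : ∀ ω, X ω ≤ Y ω) :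
    EQcond F P Q t X ≤ᵐ[P] EQcond F P Q t Y :=
  condExp_mono (integrable_xiBar_mul hs hm hQP hPQ hX) (integrable_xiBar_mul hs hm hQP hPQ hY)
    (Eventually.of_forall fun ω => mul_le_mul_of_nonneg_left (hXY ω) (xiBar_nonneg F P Q t ω))

lemma EQcond_add {F : ℕ → MeasurableSpace Ω} {P Q : Measure Ω} [IsFiniteMeasure P]
    [IsFiniteMeasure Q] {s t : ℕ} (hs : F s ≤ m0) (hm : F t ≤ m0) (hQP : Q ≪ P) (hPQ : P ≪ Q)
    {X Y : Ω → ℝ} (hX : X ∈ Linf F s) (hY : Y ∈ Linf F s) :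
    EQcond F P Q t (fun ω => X ω + Y ω) =ᵐ[P]
      fun ω => EQcond F P Q t X ω + EQcond F P Q t Y ω := by
  have h := condExp_add (m := F t) (integrable_xiBar_mul hs hm hQP hPQ hX)
    (integrable_xiBar_mul hs hm hQP hPQ hY)
  unfold EQcond
  simp only [mul_add]
  exact h

lemma EQcond_mul {F : ℕ → MeasurableSpace Ω} {P Q : Measure Ω} [IsFiniteMeasure P]
    [IsFiniteMeasure Q] {s t : ℕ} (hs : F s ≤ m0) (hm : F t ≤ m0) (hQP : Q ≪ P) (hPQ : P ≪ Q)
    {a X : Ω → ℝ} (ha : a ∈ Linf F t) (hX : X ∈ Linf F s) :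
    EQcond F P Q t (fun ω => a ω * X ω) =ᵐ[P] fun ω => a ω * EQcond F P Q t X ω := by
  obtain ⟨C, hC⟩ := ha.2
  have h := condExp_stronglyMeasurable_mul_of_bound hm (Measurable.stronglyMeasurable ha.1)
    (integrable_xiBar_mul hs hm hQP hPQ hX) C (Eventually.of_forall hC)
  have e : (fun ω => xiBar F P Q t ω * (a ω * X ω)) = a * fun ω => xiBar F P Q t ω * X ω := by
    ext ω
    simp only [Pi.mul_apply]
    ring
  unfold EQcond
  rw [e]
  exact h

lemma EQcond_self {F : ℕ → MeasurableSpace Ω} {P Q : Measure Ω} [IsFiniteMeasure P]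
    [IsFiniteMeasure Q] {t : ℕ} (hm : F t ≤ m0) (hQP : Q ≪ P) (hPQ : P ≪ Q)
    {a : Ω → ℝ} (ha : a ∈ Linf F t) : EQcond F P Q t a =ᵐ[P] a := by
  have h1 : (fun _ => 1 : Ω → ℝ) ∈ Linf F t := ⟨measurable_const, 1, fun ω => by simp⟩
  have h := EQcond_mul hm hm hQP hPQ ha h1
  have e : EQcond F P Q t (fun _ => 1) = P[xiBar F P Q t | F t] := by simp [EQcond]
  simp only [mul_one] at h
  filter_upwards [h, condExp_xiBar hm hQP hPQ] with ω h2 h3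
  rw [h2, e, h3, Pi.one_apply, mul_one]

end CondExp

section ERealArith

private lemma ereal_sub_coe_add (b : EReal) (x y : ℝ) :
    b - ((x + y : ℝ) : EReal) = b - (x : EReal) - (y : EReal) := by
  induction b with
  | bot => simp
  | top => rw [EReal.top_sub_coe, EReal.top_sub_coe, EReal.top_sub_coe]
  | coe b => norm_cast; ring

private lemma ereal_sub_coe_convex {b : EReal} {x y p q l : ℝ} (h0 : 0 ≤ l) (h1 : l ≤ 1)
    (hx : b - (x : EReal) ≤ p) (hy : b - (y : EReal) ≤ q) :
    b - ((l * x + (1 - l) * y : ℝ) : EReal) ≤ ((l * p + (1 - l) * q : ℝ) : EReal) := by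
  induction b with
  | bot => simp
  | top => simp at hx
  | coe b =>
    norm_cast at *
    nlinarith [mul_le_mul_of_nonneg_left hx h0, mul_le_mul_of_nonneg_left hy (sub_nonneg.2 h1)]

end ERealArith

section Linf

lemma add_mem_Linf {F : ℕ → MeasurableSpace Ω} {s : ℕ} {X Y : Ω → ℝ}
    (hX : X ∈ Linf F s) (hY : Y ∈ Linf F s) : (fun ω => X ω + Y ω) ∈ Linf F s := by
  obtain ⟨hXm, C, hC⟩ := hX
  obtain ⟨hYm, D, hD⟩ := hY
  exact ⟨Measurable.add hXm hYm, C + D,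
    fun ω => (abs_add_le _ _).trans (add_le_add (hC ω) (hD ω))⟩

lemma mul_mem_Linf {F : ℕ → MeasurableSpace Ω} {s : ℕ} {X Y : Ω → ℝ}
    (hX : X ∈ Linf F s) (hY : Y ∈ Linf F s) : (fun ω => X ω * Y ω) ∈ Linf F s := by
  obtain ⟨hXm, C, hC⟩ := hX
  obtain ⟨hYm, D, hD⟩ := hY
  refine ⟨Measurable.mul hXm hYm, C * D, fun ω => ?_⟩
  rw [abs_mul]
  exact mul_le_mul (hC ω) (hD ω) (abs_nonneg _) ((abs_nonneg _).trans (hC ω))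

lemma const_mem_Linf (F : ℕ → MeasurableSpace Ω) (s : ℕ) (c : ℝ) :
    (fun _ => c) ∈ Linf F s :=
  ⟨measurable_const, |c|, fun _ => le_rfl⟩

lemma Linf_mono {F : ℕ → MeasurableSpace Ω} {s t : ℕ} (h : F s ≤ F t) {X : Ω → ℝ}
    (hX : X ∈ Linf F s) : X ∈ Linf F t :=
  ⟨Measurable.mono hX.1 h le_rfl, hX.2⟩

end Linf

section Dual

variable [m0 : MeasurableSpace Ω]

/-- The family `{−β(Q) − E^Q[Z | F_t] : Q ∈ 𝒬}` whose essential supremum is the univariate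
conditional risk of `Z`. -/
def dualFamily (F : ℕ → MeasurableSpace Ω) (P : Measure Ω) (t : ℕ) (𝒬 : Set (Measure Ω))
    (beta : Measure Ω → Ω → EReal) (Z : Ω → ℝ) : Set (Ω → EReal) :=
  {h | ∃ Q ∈ 𝒬, h = fun ω => -beta Q ω - ((EQcond F P Q t Z ω : ℝ) : EReal)}

lemma isEssSupSetE_dualFamily_iff {F : ℕ → MeasurableSpace Ω} {P : Measure Ω} {t : ℕ}
    {𝒬 : Set (Measure Ω)} {beta : Measure Ω → Ω → EReal} {Z : Ω → ℝ} {g : Ω → EReal} :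
    IsEssSupSetE P (dualFamily F P t 𝒬 beta Z) g ↔
      (∀ Q ∈ 𝒬, ∀ᵐ ω ∂P, -beta Q ω - ((EQcond F P Q t Z ω : ℝ) : EReal) ≤ g ω) ∧
      ∀ h : Ω → EReal,
        (∀ Q ∈ 𝒬, ∀ᵐ ω ∂P, -beta Q ω - ((EQcond F P Q t Z ω : ℝ) : EReal) ≤ h ω) →
          g ≤ᵐ[P] h := by
  constructor
  · rintro ⟨h1, h2⟩
    exact ⟨fun Q hQ => h1 _ ⟨Q, hQ, rfl⟩,
      fun h hh => h2 h (by rintro _ ⟨Q, hQ, rfl⟩; exact hh Q hQ)⟩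
  · rintro ⟨h1, h2⟩
    exact ⟨by rintro _ ⟨Q, hQ, rfl⟩; exact h1 Q hQ,
      fun h hh => h2 h fun Q hQ => hh _ ⟨Q, hQ, rfl⟩⟩

lemma IsEssSupSetE.ae_unique {P : Measure Ω} {A : Set (Ω → EReal)} {g h : Ω → EReal}
    (hg : IsEssSupSetE P A g) (hh : IsEssSupSetE P A h) : g =ᵐ[P] h := by
  filter_upwards [hg.2 h hh.1, hh.2 g hg.1] with ω h1 h2
  exact le_antisymm h1 h2

lemma memLinfE_of_bounded {F : ℕ → MeasurableSpace Ω} {P : Measure Ω} {t : ℕ}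
    {g g' : Ω → EReal} (hg' : Measurable[F t] g') (hgg' : g =ᵐ[P] g')
    {C : ℝ} (hlb : ∀ᵐ ω ∂P, ((-C : ℝ) : EReal) ≤ g ω) (hub : ∀ᵐ ω ∂P, g ω ≤ (C : EReal)) :
    MemLinfE F P t g := by
  refine ⟨fun ω => max (-|C|) (min |C| (g' ω).toReal),
    ⟨measurable_const.max (measurable_const.min (measurable_ereal_toReal.comp hg')), |C|,
      fun ω => abs_le.2 ⟨le_max_left _ _, max_le ?_ (min_le_left _ _)⟩⟩, ?_⟩
  · linarith [abs_nonneg C]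
  · filter_upwards [hgg', hlb, hub] with ω h1 h2 h3
    rw [← h1]
    have hbot : g ω ≠ ⊥ := ne_bot_of_le_ne_bot (EReal.coe_ne_bot _) h2
    have htop : g ω ≠ ⊤ := ne_top_of_le_ne_top (EReal.coe_ne_top _) h3
    lift g ω to ℝ using ⟨htop, hbot⟩ with x
    rw [EReal.coe_le_coe_iff] at h2 h3
    rw [EReal.toReal_coe, min_eq_right (h3.trans (le_abs_self C)),
      max_eq_right ((neg_le_neg (le_abs_self C)).trans h2)]

variable {F : ℕ → MeasurableSpace Ω} {P : Measure Ω} [IsFiniteMeasure P] {s t : ℕ}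
  {𝒬 : Set (Measure Ω)} {beta : Measure Ω → Ω → EReal}

lemma dualFamily_cash (hs : F s ≤ m0) (hm : F t ≤ m0) (hts : F t ≤ F s)
    (h𝒬 : ∀ Q ∈ 𝒬, IsProbabilityMeasure Q ∧ Q ≪ P ∧ P ≪ Q) {Z m : Ω → ℝ}
    (hZ : Z ∈ Linf F s) (hmL : m ∈ Linf F t) {g g' : Ω → EReal}
    (hg : IsEssSupSetE P (dualFamily F P t 𝒬 beta Z) g)
    (hg' : IsEssSupSetE P (dualFamily F P t 𝒬 beta fun ω => Z ω + m ω) g') :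
    g' =ᵐ[P] fun ω => g ω - ((m ω : ℝ) : EReal) := by
  rw [isEssSupSetE_dualFamily_iff] at hg hg'
  have key : ∀ Q ∈ 𝒬, EQcond F P Q t (fun ω => Z ω + m ω) =ᵐ[P]
      fun ω => EQcond F P Q t Z ω + m ω := by
    intro Q hQ
    obtain ⟨_, hQP, hPQ⟩ := h𝒬 Q hQ
    filter_upwards [EQcond_add hs hm hQP hPQ hZ (Linf_mono hts hmL), EQcond_self hm hQP hPQ hmL]
      with ω h1 h2
    rw [h1, h2]
  have h1 : g' ≤ᵐ[P] fun ω => g ω - ((m ω : ℝ) : EReal) := by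
    refine hg'.2 _ fun Q hQ => ?_
    filter_upwards [key Q hQ, hg.1 Q hQ] with ω h1 h2
    rw [h1, ereal_sub_coe_add]
    exact EReal.sub_le_sub h2 le_rfl
  have h2 : g ≤ᵐ[P] fun ω => g' ω - ((-m ω : ℝ) : EReal) := by
    refine hg.2 _ fun Q hQ => ?_
    filter_upwards [key Q hQ, hg'.1 Q hQ] with ω h1 h2
    rw [h1] at h2
    have e : EQcond F P Q t Z ω = (EQcond F P Q t Z ω + m ω) + -m ω := by ring
    rw [e, ereal_sub_coe_add]
    exact EReal.sub_le_sub h2 le_rfl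
  filter_upwards [h1, h2] with ω h1 h2
  refine le_antisymm h1 ((EReal.sub_le_sub h2 le_rfl).trans_eq ?_)
  rw [← ereal_sub_coe_add]
  simp

lemma dualFamily_mono (hs : F s ≤ m0) (hm : F t ≤ m0)
    (h𝒬 : ∀ Q ∈ 𝒬, IsProbabilityMeasure Q ∧ Q ≪ P ∧ P ≪ Q) {Z₁ Z₂ : Ω → ℝ}
    (hZ₁ : Z₁ ∈ Linf F s) (hZ₂ : Z₂ ∈ Linf F s) (hle : ∀ ω, Z₂ ω ≤ Z₁ ω) {g₁ g₂ : Ω → EReal}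
    (hg₁ : IsEssSupSetE P (dualFamily F P t 𝒬 beta Z₁) g₁)
    (hg₂ : IsEssSupSetE P (dualFamily F P t 𝒬 beta Z₂) g₂) : g₁ ≤ᵐ[P] g₂ := by
  rw [isEssSupSetE_dualFamily_iff] at hg₁ hg₂
  refine hg₁.2 _ fun Q hQ => ?_
  obtain ⟨_, hQP, hPQ⟩ := h𝒬 Q hQ
  filter_upwards [EQcond_mono hs hm hQP hPQ hZ₂ hZ₁ hle, hg₂.1 Q hQ] with ω h1 h2
  exact (EReal.sub_le_sub le_rfl (EReal.coe_le_coe_iff.2 h1)).trans h2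

/-- If the penalties have `F_t`-measurable versions, then so does the conditional risk of `Z`. -/
lemma dualFamily_exists_measurable (hm : F t ≤ m0)
    (hbeta : ∀ Q ∈ 𝒬, ∃ b, Measurable[F t] b ∧ beta Q =ᵐ[P] b) {Z : Ω → ℝ} {g : Ω → EReal}
    (hg : IsEssSupSetE P (dualFamily F P t 𝒬 beta Z) g) :
    ∃ g', Measurable[F t] g' ∧ g =ᵐ[P] g' := by
  refine hg.exists_measurable hm ?_
  rintro _ ⟨Q, hQ, rfl⟩
  obtain ⟨b, hb, hbe⟩ := hbeta Q hQ
  have hE : Measurable[F t] fun ω => ((EQcond F P Q t Z ω : ℝ) : EReal) :=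
    measurable_coe_real_ereal.comp stronglyMeasurable_condExp.measurable
  refine ⟨fun ω => -b ω - ((EQcond F P Q t Z ω : ℝ) : EReal), hb.neg.sub hE, ?_⟩
  filter_upwards [hbe] with ω h
  rw [h]

lemma IsPenalty.exists_measurable {d T : ℕ} {A : Set (Ω → Fin d → ℝ)} {Q : Measure Ω}
    {S : ℕ → Ω → Fin d → ℝ} {b : Ω → EReal} (hm : F t ≤ m0)
    (hb : IsPenalty F P d T t A Q S b) : ∃ b', Measurable[F t] b' ∧ b =ᵐ[P] b' := by
  refine IsEssSupSetE.exists_measurable hm hb ?_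
  rintro _ ⟨Z, -, rfl⟩
  exact ⟨_, measurable_coe_real_ereal.comp
    (Measurable.neg stronglyMeasurable_condExp.measurable), EventuallyEq.rfl⟩

lemma dualFamily_memLinfE (hs : F s ≤ m0) (hm : F t ≤ m0) (hts : F t ≤ F s)
    (h𝒬 : ∀ Q ∈ 𝒬, IsProbabilityMeasure Q ∧ Q ≪ P ∧ P ≪ Q)
    (hbeta : ∀ Q ∈ 𝒬, ∃ b, Measurable[F t] b ∧ beta Q =ᵐ[P] b)
    {φ : (Ω → ℝ) → Ω → EReal}
    (hφ : ∀ Z ∈ Linf F s, IsEssSupSetE P (dualFamily F P t 𝒬 beta Z) (φ Z))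
    (h0 : MemLinfE F P t (φ fun _ => 0)) {Z : Ω → ℝ} (hZ : Z ∈ Linf F s) :
    MemLinfE F P t (φ Z) := by
  obtain ⟨g', hg', hgg'⟩ := dualFamily_exists_measurable hm hbeta (hφ Z hZ)
  obtain ⟨x, ⟨-, D, hD⟩, hx⟩ := h0
  obtain ⟨C, hC⟩ := hZ.2
  have hcst : ∀ c : ℝ, φ (fun _ => c) =ᵐ[P] fun ω => ((x ω - c : ℝ) : EReal) := by
    intro c
    have h0L := const_mem_Linf F s 0
    have hcL := const_mem_Linf F t c
    have h := dualFamily_cash hs hm hts h𝒬 h0L hcL (hφ _ h0L) (hφ _ (add_mem_Linf h0L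
      (const_mem_Linf F s c)))
    simp only [zero_add] at h
    filter_upwards [h, hx] with ω h1 h2
    rw [h1, h2, EReal.coe_sub]
  have hub := dualFamily_mono hs hm h𝒬 hZ (const_mem_Linf F s (-C))
    (fun ω => (abs_le.1 (hC ω)).1) (hφ _ hZ) (hφ _ (const_mem_Linf F s (-C)))
  have hlb := dualFamily_mono hs hm h𝒬 (const_mem_Linf F s C) hZ
    (fun ω => (abs_le.1 (hC ω)).2) (hφ _ (const_mem_Linf F s C)) (hφ _ hZ)
  refine memLinfE_of_bounded (C := C + D) hg' hgg' ?_ ?_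
  · filter_upwards [hlb, hcst C] with ω h1 h2
    refine le_trans ?_ (h2 ▸ h1)
    rw [EReal.coe_le_coe_iff]
    linarith [(abs_le.1 (hD ω)).1]
  · filter_upwards [hub, hcst (-C)] with ω h1 h2
    refine le_trans (h2 ▸ h1) ?_
    rw [EReal.coe_le_coe_iff]
    linarith [(abs_le.1 (hD ω)).2]

lemma dualFamily_convex (hs : F s ≤ m0) (hm : F t ≤ m0) (hts : F t ≤ F s)
    (h𝒬 : ∀ Q ∈ 𝒬, IsProbabilityMeasure Q ∧ Q ≪ P ∧ P ≪ Q) {Z₁ Z₂ lam : Ω → ℝ}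
    (hZ₁ : Z₁ ∈ Linf F s) (hZ₂ : Z₂ ∈ Linf F s) (hlam : lam ∈ Linf F t)
    (hlam01 : ∀ ω, lam ω ∈ Set.Icc (0 : ℝ) 1) {g g₁ g₂ : Ω → EReal}
    (hg : IsEssSupSetE P
      (dualFamily F P t 𝒬 beta fun ω => lam ω * Z₁ ω + (1 - lam ω) * Z₂ ω) g)
    (hg₁ : IsEssSupSetE P (dualFamily F P t 𝒬 beta Z₁) g₁)
    (hg₂ : IsEssSupSetE P (dualFamily F P t 𝒬 beta Z₂) g₂)
    (hfin₁ : MemLinfE F P t g₁) (hfin₂ : MemLinfE F P t g₂) :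
    g ≤ᵐ[P] fun ω => ((lam ω : ℝ) : EReal) * g₁ ω + ((1 - lam ω : ℝ) : EReal) * g₂ ω := by
  rw [isEssSupSetE_dualFamily_iff] at hg hg₁ hg₂
  obtain ⟨x₁, -, hx₁⟩ := hfin₁
  obtain ⟨x₂, -, hx₂⟩ := hfin₂
  have hlam' : (fun ω => 1 - lam ω) ∈ Linf F t := by
    have h := add_mem_Linf (const_mem_Linf F t 1) (mul_mem_Linf (const_mem_Linf F t (-1)) hlam)
    simpa [← sub_eq_add_neg] using h
  refine hg.2 _ fun Q hQ => ?_
  obtain ⟨_, hQP, hPQ⟩ := h𝒬 Q hQ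
  filter_upwards [EQcond_add hs hm hQP hPQ (mul_mem_Linf (Linf_mono hts hlam) hZ₁)
    (mul_mem_Linf (Linf_mono hts hlam') hZ₂), EQcond_mul hs hm hQP hPQ hlam hZ₁,
    EQcond_mul hs hm hQP hPQ hlam' hZ₂, hg₁.1 Q hQ, hg₂.1 Q hQ, hx₁, hx₂]
    with ω h1 h2 h3 h4 h5 h6 h7
  rw [h6] at h4
  rw [h7] at h5
  rw [h1, h2, h3, h6, h7]
  exact_mod_cast ereal_sub_coe_convex (hlam01 ω).1 (hlam01 ω).2 h4 h5

lemma dualFamily_coherent (hs : F s ≤ m0) (hm : F t ≤ m0)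
    (h𝒬 : ∀ Q ∈ 𝒬, IsProbabilityMeasure Q ∧ Q ≪ P ∧ P ≪ Q)
    (hbeta : ∀ Q ∈ 𝒬, ∀ᵐ ω ∂P, beta Q ω = 0 ∨ beta Q ω = ⊤) {Z lam : Ω → ℝ}
    (hZ : Z ∈ Linf F s) (hlam : lam ∈ Linf F t) (hlam0 : ∀ ω, 0 ≤ lam ω)
    {g₀ g g' : Ω → EReal}
    (hg₀ : IsEssSupSetE P (dualFamily F P t 𝒬 beta fun _ => 0) g₀)
    (hg : IsEssSupSetE P (dualFamily F P t 𝒬 beta Z) g)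
    (hg' : IsEssSupSetE P (dualFamily F P t 𝒬 beta fun ω => lam ω * Z ω) g')
    (hfin₀ : MemLinfE F P t g₀) (hfin : MemLinfE F P t g) (hfin' : MemLinfE F P t g') :
    g' =ᵐ[P] fun ω => ((lam ω : ℝ) : EReal) * g ω := by
  rw [isEssSupSetE_dualFamily_iff] at hg₀ hg hg'
  obtain ⟨x₀, -, hx₀⟩ := hfin₀
  obtain ⟨x, -, hx⟩ := hfin
  obtain ⟨x', -, hx'⟩ := hfin'
  have hE0 : ∀ Q : Measure Ω, EQcond F P Q t (fun _ => 0) = 0 := fun Q => by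
    simp only [EQcond, mul_zero]
    exact condExp_zero
  have hmul : ∀ Q ∈ 𝒬, EQcond F P Q t (fun ω => lam ω * Z ω) =ᵐ[P]
      fun ω => lam ω * EQcond F P Q t Z ω := fun Q hQ => by
    obtain ⟨_, hQP, hPQ⟩ := h𝒬 Q hQ
    exact EQcond_mul hs hm hQP hPQ hlam hZ
  have hle : g' ≤ᵐ[P] fun ω => ((lam ω : ℝ) : EReal) * g ω := by
    refine hg'.2 _ fun Q hQ => ?_
    filter_upwards [hbeta Q hQ, hmul Q hQ, hg.1 Q hQ, hx] with ω h1 h2 h3 h4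
    rcases h1 with h1 | h1
    · rw [h4, h1] at h3
      rw [h2, h4, h1]
      simp only [neg_zero, zero_sub] at h3 ⊢
      norm_cast at h3 ⊢
      linarith [mul_le_mul_of_nonneg_left h3 (hlam0 ω)]
    · simp [h1]
  -- the value at `0` vanishes, since it is finite and a supremum of values in `{0, -∞}`
  have hnonneg : ∀ᵐ ω ∂P, 0 ≤ g₀ ω := by
    have h : g₀ ≤ᵐ[P] fun ω => if g₀ ω < 0 then ⊥ else g₀ ω := by
      refine hg₀.2 _ fun Q hQ => ?_
      filter_upwards [hbeta Q hQ, hg₀.1 Q hQ] with ω h1 h2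
      rw [hE0] at h2 ⊢
      split_ifs with hneg
      · rcases h1 with h1 | h1
        · rw [h1] at h2
          simp at h2
          exact absurd hneg h2.not_gt
        · simp [h1]
      · exact h2
    filter_upwards [h, hx₀] with ω h h0
    by_contra! hneg
    rw [if_pos hneg, h0] at h
    simp at h
  have hzero : ∀ᵐ ω ∂P, lam ω = 0 → 0 ≤ g' ω := by
    have h : g₀ ≤ᵐ[P] fun ω => if lam ω = 0 then g' ω else ⊤ := by
      refine hg₀.2 _ fun Q hQ => ?_
      filter_upwards [hmul Q hQ, hg'.1 Q hQ] with ω h1 h2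
      rw [hE0]
      split_ifs with hl
      · simpa [h1, hl] using h2
      · exact le_top
    filter_upwards [h, hnonneg] with ω h h0 hl
    rw [if_pos hl] at h
    exact h0.trans h
  have hpos : ∀ᵐ ω ∂P, 0 < lam ω → ((lam ω : ℝ) : EReal) * g ω ≤ g' ω := by
    have h : g ≤ᵐ[P] fun ω => if 0 < lam ω then ((x' ω / lam ω : ℝ) : EReal) else ⊤ := by
      refine hg.2 _ fun Q hQ => ?_
      filter_upwards [hbeta Q hQ, hmul Q hQ, hg'.1 Q hQ, hx'] with ω h1 h2 h3 h4
      split_ifs with hl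
      · rcases h1 with h1 | h1
        · rw [h2, h4, h1] at h3
          rw [h1]
          simp only [neg_zero, zero_sub] at h3 ⊢
          norm_cast at h3 ⊢
          rw [le_div_iff₀ hl]
          linarith
        · simp [h1]
      · exact le_top
    filter_upwards [h, hx, hx'] with ω h1 h2 h3 hl
    rw [if_pos hl, h2, EReal.coe_le_coe_iff, le_div_iff₀ hl] at h1
    rw [h2, h3]
    norm_cast
    linarith
  filter_upwards [hle, hzero, hpos] with ω h1 h2 h3
  refine le_antisymm h1 ?_
  rcases (hlam0 ω).eq_or_lt with hl | hl
  · simpa [← hl] using h2 hl.symm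
  · exact h3 hl

end Dual

section Portfolio

lemma dot_smul_right {d : ℕ} (x y : Fin d → ℝ) (c : ℝ) : dot x (c • y) = c * dot x y := by
  simp only [dot, Pi.smul_apply, smul_eq_mul, Finset.mul_sum]
  exact Finset.sum_congr rfl fun i _ => by ring

lemma dot_e1 {d : ℕ} (hd : 0 < d) {y : Fin d → ℝ} (hy : ∀ i : Fin d, (i : ℕ) = 0 → y i = 1) :
    dot y (e1 d) = 1 := by
  rw [dot, Finset.sum_eq_single ⟨0, hd⟩]
  · simp [e1, hy ⟨0, hd⟩ rfl]
  · intro i _ hi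
    have : (i : ℕ) ≠ 0 := fun h => hi (Fin.ext h)
    simp [e1, this]
  · simp

lemma smul_e1_mem_LinfD {F : ℕ → MeasurableSpace Ω} {s : ℕ} (d : ℕ) {Z : Ω → ℝ}
    (hZ : Z ∈ Linf F s) : (fun ω => Z ω • e1 d) ∈ LinfD F d s := by
  obtain ⟨hZm, C, hC⟩ := hZ
  refine ⟨?_, C, fun ω i => ?_⟩
  · let := F s
    exact measurable_pi_lambda _ fun i => Measurable.mul_const hZm (e1 d i)
  · have h0 : 0 ≤ C := (abs_nonneg _).trans (hC ω)
    by_cases hi : (i : ℕ) = 0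
    · simpa [e1, hi] using hC ω
    · simpa [e1, hi] using h0

lemma dot_mem_Linf {F : ℕ → MeasurableSpace Ω} {d s : ℕ} {X Y : Ω → Fin d → ℝ}
    (hX : X ∈ LinfD F d s) (hY : Y ∈ LinfD F d s) :
    (fun ω => dot (X ω) (Y ω)) ∈ Linf F s := by
  obtain ⟨hXm, C, hC⟩ := hX
  obtain ⟨hYm, D, hD⟩ := hY
  refine ⟨?_, ∑ _i : Fin d, C * D, fun ω => ?_⟩
  · let := F s
    exact Finset.measurable_sum _ fun i _ =>
      ((measurable_pi_apply i).comp hXm).mul ((measurable_pi_apply i).comp hYm)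
  · refine (Finset.abs_sum_le_sum_abs _ _).trans (Finset.sum_le_sum fun i _ => ?_)
    rw [abs_mul]
    exact mul_le_mul (hC ω i) (hD ω i) (abs_nonneg _) ((abs_nonneg _).trans (hC ω i))

variable [m0 : MeasurableSpace Ω]

lemma ScalarRM.dim_pos {F : ℕ → MeasurableSpace Ω} {P : Measure Ω} [IsProbabilityMeasure P]
    {d T t : ℕ} {rho : (Ω → Fin d → ℝ) → Ω → ℝ} (hrho : ScalarRM F P d T t rho) : 0 < d := by
  rcases Nat.eq_zero_or_pos d with rfl | hd
  · have h := hrho.cash (fun _ _ => 0) ⟨measurable_const, 0, fun _ _ => by simp⟩ (fun _ => 1)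
      (const_mem_Linf F t 1)
    rw [Subsingleton.elim (fun ω : Ω => (fun _ => 0 : Fin 0 → ℝ) + (1 : ℝ) • e1 0)
      fun _ _ => 0] at h
    obtain ⟨ω, hω⟩ := h.exists
    linarith
  · exact hd

lemma ScalarRM.acc_nonempty {F : ℕ → MeasurableSpace Ω} {P : Measure Ω}
    {d T t : ℕ} (hts : F t ≤ F T) {rho : (Ω → Fin d → ℝ) → Ω → ℝ}
    (hrho : ScalarRM F P d T t rho) : (Acc F P d T rho).Nonempty := by
  have h0 : (fun _ _ => 0 : Ω → Fin d → ℝ) ∈ LinfD F d T :=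
    ⟨measurable_const, 0, fun _ _ => by simp⟩
  obtain ⟨g, hg, hgr⟩ := hrho.finite _ h0
  have e : (fun ω => (fun _ => 0 : Fin d → ℝ) + g ω • e1 d) = fun ω => g ω • e1 d := by
    ext ω i
    simp
  have hc := hrho.cash _ h0 g hg
  rw [e] at hc
  refine ⟨fun ω => g ω • e1 d, smul_e1_mem_LinfD d (Linf_mono hts hg), ?_⟩
  filter_upwards [hc, hgr] with ω h1 h2
  rw [h1, h2, sub_self]

/-- The penalty function of a conditional cone takes only the values `0` and `+∞`. -/
lemma IsPenalty.eq_zero_or_top {F : ℕ → MeasurableSpace Ω} {P Q : Measure Ω}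
    [IsFiniteMeasure P] [IsFiniteMeasure Q] {d T t : ℕ} (hT : F T ≤ m0) (hm : F t ≤ m0)
    (hQP : Q ≪ P) (hPQ : P ≪ Q) {A : Set (Ω → Fin d → ℝ)} (hA : A ⊆ LinfD F d T)
    (hne : A.Nonempty)
    (hcone : ∀ X ∈ A, ∀ lam ∈ Linf F t, (∀ ω, 0 ≤ lam ω) → (fun ω => lam ω • X ω) ∈ A)
    {S : ℕ → Ω → Fin d → ℝ} (hS : S T ∈ LinfD F d T) {b : Ω → EReal}
    (hb : IsPenalty F P d T t A Q S b) : ∀ᵐ ω ∂P, b ω = 0 ∨ b ω = ⊤ := by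
  have hscale : ∀ X ∈ A, ∀ c : ℝ, 0 ≤ c → ∀ᵐ ω ∂P,
      ((-(c * EQcond F P Q t (fun ω' => dot (S T ω') (X ω')) ω) : ℝ) : EReal) ≤ b ω := by
    intro X hX c hc
    have h := hb.1 _ ⟨_, hcone X hX (fun _ => c) (const_mem_Linf F t c) (fun _ => hc), rfl⟩
    simp only [dot_smul_right] at h
    filter_upwards [h, EQcond_mul hT hm hQP hPQ (const_mem_Linf F t c)
      (dot_mem_Linf hS (hA hX))] with ω h1 h2
    rwa [h2] at h1
  have hnonneg : ∀ᵐ ω ∂P, 0 ≤ b ω := by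
    obtain ⟨X, hX⟩ := hne
    filter_upwards [hscale X hX 0 le_rfl] with ω h
    simpa using h
  have hle : ∀ᵐ ω ∂P, b ω ≤ if b ω = ⊤ then ⊤ else 0 := by
    refine hb.2 _ ?_
    rintro _ ⟨X, hX, rfl⟩
    have h : ∀ᵐ ω ∂P, ∀ n : ℕ,
        ((-((n : ℝ) * EQcond F P Q t (fun ω' => dot (S T ω') (X ω')) ω) : ℝ) : EReal) ≤ b ω :=
      ae_all_iff.2 fun n => hscale X hX n n.cast_nonneg
    filter_upwards [h, hnonneg] with ω h h0
    split_ifs with htop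
    · exact le_top
    · lift b ω to ℝ using ⟨htop, ne_bot_of_le_ne_bot EReal.zero_ne_bot h0⟩ with y
      rw [← EReal.coe_zero, EReal.coe_le_coe_iff]
      by_contra! hpos
      obtain ⟨n, hn⟩ := exists_lt_nsmul hpos y
      have hny := EReal.coe_le_coe_iff.1 (h n)
      rw [nsmul_eq_mul] at hn
      linarith
  filter_upwards [hnonneg, hle] with ω h0 h1
  split_ifs at h1 with htop
  · exact Or.inr htop
  · exact Or.inl (le_antisymm h1 h0)

end Portfolio

/-- Proposition 5.11.  For `S ∈ 𝒮_t`, the map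
`φ_t^S(Z) := π_t^S(Z e₁)` is a univariate conditional convex risk measure:
it maps `L^∞(F)` into `L^∞(F_t)`, is conditionally cash invariant, monotone and
conditionally convex; it is coherent when the acceptance set is a conditional cone.
Moreover `π_t^S(X) = φ_t^S(S_T^⊤ X)` for every `X ∈ L^∞_d(F)`. -/
theorem statement11 [MeasurableSpace Ω] (F : ℕ → MeasurableSpace Ω) (P : Measure Ω)
    [IsProbabilityMeasure P] (d T t : ℕ) (ht : t ≤ T) (K : ℕ → Ω → Set (Fin d → ℝ))
    (hFil : FiltrationOK F P T) (hK : ConesOK K) (hKbar : FrictionAssumption P T K)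
    (rho : (Ω → Fin d → ℝ) → Ω → ℝ)
    (hrho : ScalarRM F P d T t rho) (hKcomp : KCompat F P d T K t rho)
    (hFatou : Fatou F P d T rho) (hRel : Relevant P d rho)
    (beta : Measure Ω → Ω → EReal)
    (S : ℕ → Ω → Fin d → ℝ) (hS : memS F d T K S)
    (hbeta : ∀ Q ∈ QeS F P d T S, IsPenalty F P d T t (Acc F P d T rho) Q S (beta Q))
    (pi : (Ω → Fin d → ℝ) → Ω → EReal)
    (hpi : ∀ X ∈ LinfD F d T, IsPi F P d T t beta S X (pi X))
    -- `S ∈ 𝒮_t`, i.e. `π_t^S(0) ∈ L^∞(F_t)`: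
    (hSt : MemLinfE F P t (pi fun _ _ => 0)) :
    -- `φ_t^S` maps `L^∞(F)` into `L^∞(F_t)`:
    (∀ Z ∈ Linf F T, MemLinfE F P t (pi fun ω => Z ω • e1 d)) ∧
    -- conditional cash invariance:
    (∀ Z ∈ Linf F T, ∀ m ∈ Linf F t,
      pi (fun ω => (Z ω + m ω) • e1 d) =ᵐ[P]
        fun ω => pi (fun ω' => Z ω' • e1 d) ω - ((m ω : ℝ) : EReal)) ∧
    -- monotonicity:
    (∀ Z₁ ∈ Linf F T, ∀ Z₂ ∈ Linf F T, (∀ ω, Z₂ ω ≤ Z₁ ω) →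
      pi (fun ω => Z₁ ω • e1 d) ≤ᵐ[P] pi fun ω => Z₂ ω • e1 d) ∧
    -- conditional convexity:
    (∀ Z₁ ∈ Linf F T, ∀ Z₂ ∈ Linf F T, ∀ lam ∈ Linf F t,
      (∀ ω, lam ω ∈ Set.Icc (0 : ℝ) 1) →
      pi (fun ω => (lam ω * Z₁ ω + (1 - lam ω) * Z₂ ω) • e1 d) ≤ᵐ[P]
        fun ω => ((lam ω : ℝ) : EReal) * pi (fun ω' => Z₁ ω' • e1 d) ω +
          (((1 - lam ω) : ℝ) : EReal) * pi (fun ω' => Z₂ ω' • e1 d) ω) ∧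
    -- coherence when the acceptance set is a conditional cone:
    ((∀ X ∈ Acc F P d T rho, ∀ lam ∈ Linf F t, (∀ ω, 0 ≤ lam ω) →
        (fun ω => lam ω • X ω) ∈ Acc F P d T rho) →
      ∀ Z ∈ Linf F T, ∀ lam ∈ Linf F t, (∀ ω, 0 ≤ lam ω) →
        pi (fun ω => (lam ω * Z ω) • e1 d) =ᵐ[P]
          fun ω => ((lam ω : ℝ) : EReal) * pi (fun ω' => Z ω' • e1 d) ω) ∧
    -- `π_t^S(X) = φ_t^S(S_T^⊤ X)`:
    (∀ X ∈ LinfD F d T,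
      pi X =ᵐ[P] pi fun ω => (dot (S T ω) (X ω)) • e1 d) := by
  obtain ⟨hmono, hle, -, -⟩ := hFil
  have hT := hle T
  have hm := hle t
  have hts := hmono t T ht
  have hd := hrho.dim_pos
  obtain ⟨hST, -, hS1, -⟩ := hS T le_rfl
  have h𝒬 : ∀ Q ∈ QeS F P d T S, IsProbabilityMeasure Q ∧ Q ≪ P ∧ P ≪ Q :=
    fun Q hQ => ⟨hQ.1, hQ.2.1, hQ.2.2.1⟩
  have hbm : ∀ Q ∈ QeS F P d T S, ∃ b, Measurable[F t] b ∧ beta Q =ᵐ[P] b :=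
    fun Q hQ => (hbeta Q hQ).exists_measurable hm
  have hdot : ∀ z : ℝ, ∀ ω, dot (S T ω) (z • e1 d) = z := fun z ω => by
    rw [dot_smul_right, dot_e1 hd (hS1 ω), mul_one]
  have hphi : ∀ Z ∈ Linf F T, IsEssSupSetE P (dualFamily F P t (QeS F P d T S) beta Z)
      (pi fun ω => Z ω • e1 d) := by
    intro Z hZ
    have h := hpi _ (smul_e1_mem_LinfD d hZ)
    simp only [IsPi, hdot] at h
    exact h
  have e0 : (fun _ _ => 0 : Ω → Fin d → ℝ) = fun _ => (0 : ℝ) • e1 d := by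
    ext ω i
    simp
  rw [e0] at hSt
  have hfin : ∀ Z ∈ Linf F T, MemLinfE F P t (pi fun ω => Z ω • e1 d) := fun Z hZ =>
    dualFamily_memLinfE (φ := fun Z => pi fun ω => Z ω • e1 d) hT hm hts h𝒬 hbm hphi hSt hZ
  refine ⟨hfin, ?_, ?_, ?_, ?_, ?_⟩
  · intro Z hZ m hmL
    exact dualFamily_cash hT hm hts h𝒬 hZ hmL (hphi Z hZ)
      (hphi _ (add_mem_Linf hZ (Linf_mono hts hmL)))
  · intro Z₁ hZ₁ Z₂ hZ₂ hZ
    exact dualFamily_mono hT hm h𝒬 hZ₁ hZ₂ hZ (hphi _ hZ₁) (hphi _ hZ₂)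
  · intro Z₁ hZ₁ Z₂ hZ₂ lam hlam hlam01
    have hlam' : (fun ω => 1 - lam ω) ∈ Linf F T := by
      have h := add_mem_Linf (const_mem_Linf F T 1)
        (mul_mem_Linf (const_mem_Linf F T (-1)) (Linf_mono hts hlam))
      simpa [← sub_eq_add_neg] using h
    exact dualFamily_convex hT hm hts h𝒬 hZ₁ hZ₂ hlam hlam01
      (hphi _ (add_mem_Linf (mul_mem_Linf (Linf_mono hts hlam) hZ₁) (mul_mem_Linf hlam' hZ₂)))
      (hphi _ hZ₁) (hphi _ hZ₂) (hfin _ hZ₁) (hfin _ hZ₂)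
  · intro hcone Z hZ lam hlam hlam0
    have hb : ∀ Q ∈ QeS F P d T S, ∀ᵐ ω ∂P, beta Q ω = 0 ∨ beta Q ω = ⊤ := by
      intro Q hQ
      obtain ⟨_, hQP, hPQ⟩ := h𝒬 Q hQ
      exact (hbeta Q hQ).eq_zero_or_top hT hm hQP hPQ (fun X hX => hX.1)
        (hrho.acc_nonempty hts) hcone hST
    have hlZ := mul_mem_Linf (Linf_mono hts hlam) hZ
    exact dualFamily_coherent hT hm h𝒬 hb hZ hlam hlam0
      (hphi _ (const_mem_Linf F T 0)) (hphi _ hZ) (hphi _ hlZ) hSt (hfin _ hZ) (hfin _ hlZ)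
  · intro X hX
    exact IsEssSupSetE.ae_unique (hpi X hX) (hphi _ (dot_mem_Linf hST hX))

end RiskPaper
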